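/- Let s ∈ ℕ, let G be a finite abelian group, let I be a finite nonempty indexing set, and for each i ∈ I let H_{i1}, …, H_{is} be subgroups of G. There exists t ∈ ℕ depending only on s such that for every 1-bounded function f : G → ℂ, ( E_{i∈I} ‖f‖_{H_{i1}, …, H_{is}}^{2^s} )^t ≤ E over all families (i_ε)_{ε∈{0,1}^s} ∈ I^{{0,1}^s} of the box norm of f along the family of subgroups H_{i_ε j} + H_{i_{ε'} j}, indexed by j ∈ {1,…,s} and by all pairs ε, ε' ∈ {0,1}^s with ε ≠ ε'. -/

import Mathlib

open Finset Polynomial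
open scoped BigOperators

noncomputable section

/-- The average of a complex-valued function over a finite type. -/
def eavg {α : Type*} [Finite α] (f : α → ℂ) : ℂ :=
  haveI := Fintype.ofFinite α
  (∑ x, f x) / (Nat.card α : ℂ)

/-- The average of a real-valued function over a finite type. -/
def eavgR {α : Type*} [Finite α] (f : α → ℝ) : ℝ :=
  haveI := Fintype.ofFinite α
  (∑ x, f x) / (Nat.card α : ℝ)

/-- Iterated complex conjugation `C^n`. -/
def conjIter (n : ℕ) (z : ℂ) : ℂ := if Even n then z else (starRingEnd ℂ) z

/-- The weight `|ε|` of a Boolean vector. -/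
def epsWt {ι : Type*} [Finite ι] (ε : ι → Bool) : ℕ :=
  haveI := Fintype.ofFinite ι
  ∑ i, if ε i then 1 else 0

/-- The Gowers box norm of `f` along a finite family of subgroups of `G`. -/
def boxNorm {G : Type*} [AddCommGroup G] [Finite G] {ι : Type*} [Finite ι]
    (H : ι → AddSubgroup G) (f : G → ℂ) : ℝ :=
  haveI := Fintype.ofFinite ι
  haveI : Fintype (ι → Bool) := Fintype.ofFinite _
  ((eavg fun x : G => eavg fun h : ∀ i, H i =>
      ∏ ε : ι → Bool,
        conjIter (epsWt ε) (f (x + ∑ i, if ε i then (h i : G) else 0))).re) ^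
    ((1 : ℝ) / 2 ^ Nat.card ι)

/-- Reduction of an integer vector modulo `p`. -/
def redv (p : ℕ) {D : ℕ} (w : Fin D → ℤ) : Fin D → ZMod p := fun k => (w k : ZMod p)

/-- The vector `v·P(n)` in `F_p^D`. -/
def pshift (p : ℕ) {D : ℕ} (v : Fin D → ℤ) (P : Polynomial ℤ) (n : ZMod p) :
    Fin D → ZMod p :=
  fun k => (v k : ZMod p) * Polynomial.aeval n P

/-- The Gowers norm of degree `s` of `f` along the direction `v`. -/
def gowersU (p : ℕ) [NeZero p] {D : ℕ} (s : ℕ) (v : Fin D → ℤ)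
    (f : (Fin D → ZMod p) → ℂ) : ℝ :=
  (eavg fun x : Fin D → ZMod p => eavg fun h : Fin s → ZMod p =>
      ∏ ε : Fin s → Bool,
        conjIter (epsWt ε)
          (f (x + fun k => (∑ i, if ε i then h i else 0) * (v k : ZMod p)))).re ^
    ((1 : ℝ) / 2 ^ s)

/-- The conditional expectation `E(f | v)`. -/
def condAvg (p : ℕ) [NeZero p] {D : ℕ} (v : Fin D → ℤ)
    (f : (Fin D → ZMod p) → ℂ) (x : Fin D → ZMod p) : ℂ :=
  eavg fun n : ZMod p => f (x + fun k => n * (v k : ZMod p))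

/-- The additive character `e_p`. -/
def ep (p : ℕ) (t : ZMod p) : ℂ :=
  Complex.exp (2 * Real.pi * Complex.I * (t.val : ℂ) / (p : ℂ))

/-- `χ` is an eigenfunction of the direction `v`. -/
def IsEigenfunction (p : ℕ) {D : ℕ} (v : Fin D → ℤ) (χ : (Fin D → ZMod p) → ℂ) : Prop :=
  ∃ φ : (Fin D → ZMod p) → ZMod p,
    (∀ x, ‖χ x‖ = 0 ∨ ‖χ x‖ = 1) ∧
    (∀ x, χ (x + redv p v) = ep p (φ x) * χ x) ∧
    (∀ x, φ (x + redv p v) = φ x)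

/-- The degree-`s'` dual function of `g` along `v`. -/
def dualFn (p : ℕ) [NeZero p] {D : ℕ} (s' : ℕ) (v : Fin D → ℤ)
    (g : (Fin D → ZMod p) → ℂ) (x : Fin D → ZMod p) : ℂ :=
  eavg fun h : Fin s' → ZMod p =>
    ∏ ε ∈ Finset.univ.filter (fun ε : Fin s' → Bool => ε ≠ fun _ => false),
      conjIter (epsWt ε)
        (g (x + fun k => (∑ i, if ε i then h i else 0) * (v k : ZMod p)))

/-- Membership in `𝔇_s(v)`. -/
def MemDual (p : ℕ) [NeZero p] {D : ℕ} (s : ℕ) (v : Fin D → ℤ)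
    (Df : (Fin D → ZMod p) → ℂ) : Prop :=
  ∃ (s' : ℕ) (g : (Fin D → ZMod p) → ℂ),
    1 ≤ s' ∧ s' ≤ s ∧ (∀ x, ‖g x‖ ≤ 1) ∧ Df = dualFn p s' v g

section Average

variable {𝕜 : Type*} [RCLike 𝕜] {α β : Type*} [Finite α] [Finite β]

/-- The average of a scalar-valued function over a finite type. -/
def avg (f : α → 𝕜) : 𝕜 :=
  haveI := Fintype.ofFinite α
  𝔼 x, f x

lemma avg_eq_expect [Fintype α] (f : α → 𝕜) : avg f = 𝔼 x, f x := by
  unfold avg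
  congr!

lemma eavg_eq_avg (f : α → ℂ) : eavg f = avg f := by
  have := Fintype.ofFinite α
  rw [avg_eq_expect, Fintype.expect_eq_sum_div_card, eavg, Nat.card_eq_fintype_card]
  congr!

lemma eavgR_eq_avg (f : α → ℝ) : eavgR f = avg f := by
  have := Fintype.ofFinite α
  rw [avg_eq_expect, Fintype.expect_eq_sum_div_card, eavgR, Nat.card_eq_fintype_card]
  congr!

lemma avg_equiv (e : α ≃ β) (f : β → 𝕜) : avg (fun a ↦ f (e a)) = avg f := by
  have := Fintype.ofFinite α
  have := Fintype.ofFinite β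
  simp only [avg_eq_expect]
  exact Fintype.expect_equiv e _ _ fun _ ↦ rfl

lemma avg_comm (f : α → β → 𝕜) :
    avg (fun a ↦ avg fun b ↦ f a b) = avg fun b ↦ avg fun a ↦ f a b := by
  have := Fintype.ofFinite α
  have := Fintype.ofFinite β
  simp only [avg_eq_expect]
  exact expect_comm _ _ _

lemma avg_prod (f : α × β → 𝕜) : avg f = avg fun a ↦ avg fun b ↦ f (a, b) := by
  have := Fintype.ofFinite α
  have := Fintype.ofFinite β
  simp only [avg_eq_expect]
  rw [← univ_product_univ, expect_product]

lemma avg_const [Nonempty α] (c : 𝕜) : avg (fun _ : α ↦ c) = c := by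
  have := Fintype.ofFinite α
  simp only [avg_eq_expect]
  exact Fintype.expect_const c

lemma mul_avg (c : 𝕜) (f : α → 𝕜) : c * avg f = avg fun a ↦ c * f a := by
  have := Fintype.ofFinite α
  simp only [avg_eq_expect, mul_expect]

lemma avg_mul (c : 𝕜) (f : α → 𝕜) : avg f * c = avg fun a ↦ f a * c := by
  have := Fintype.ofFinite α
  simp only [avg_eq_expect, expect_mul]

lemma conj_avg (f : α → ℂ) :
    (starRingEnd ℂ) (avg f) = avg fun a ↦ (starRingEnd ℂ) (f a) := by
  have := Fintype.ofFinite α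
  simp only [avg_eq_expect, Fintype.expect_eq_sum_div_card, map_div₀, map_sum, map_natCast]

lemma ofReal_avg (f : α → ℝ) : ((avg f : ℝ) : ℂ) = avg fun a ↦ (f a : ℂ) := by
  have := Fintype.ofFinite α
  simp only [avg_eq_expect, Fintype.expect_eq_sum_div_card]
  push_cast
  rfl

lemma norm_avg_le (f : α → 𝕜) : ‖avg f‖ ≤ avg fun a ↦ ‖f a‖ := by
  have := Fintype.ofFinite α
  simp only [avg_eq_expect]
  exact RCLike.norm_expect_le (K := 𝕜)

lemma avg_mono {f g : α → ℝ} (h : ∀ a, f a ≤ g a) : avg f ≤ avg g := by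
  have := Fintype.ofFinite α
  simp only [avg_eq_expect]
  exact expect_le_expect fun a _ ↦ h a

lemma avg_nonneg {f : α → ℝ} (h : ∀ a, 0 ≤ f a) : 0 ≤ avg f := by
  have := Fintype.ofFinite α
  simp only [avg_eq_expect]
  exact expect_nonneg fun a _ ↦ h a

lemma avg_norm_eq {f : α → ℂ} (h : ∀ a, f a = (‖f a‖ : ℂ)) :
    (avg fun a ↦ ‖f a‖) = ‖avg f‖ := by
  have : avg f = ((avg fun a ↦ ‖f a‖ : ℝ) : ℂ) := by
    rw [ofReal_avg]
    congr! 2 with a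
    exact h a
  rw [this, Complex.norm_real, Real.norm_of_nonneg (avg_nonneg fun _ ↦ norm_nonneg _)]

lemma avg_pow_le {f : α → ℝ} (h : ∀ a, 0 ≤ f a) {n : ℕ} (hn : n ≠ 0) :
    avg f ^ n ≤ avg fun a ↦ f a ^ n := by
  have := Fintype.ofFinite α
  simp only [avg_eq_expect]
  rcases isEmpty_or_nonempty α with hα | hα
  · simp [hn]
  · simp only [Fintype.expect_eq_sum_div_card, div_eq_inv_mul, mul_sum]
    exact Real.pow_arith_mean_le_arith_mean_pow _ _ _ (by intros; positivity)
      (by simp) (fun a _ ↦ h a) n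

lemma avg_pow_le_avg {f g : α → ℝ} (hf : ∀ a, 0 ≤ f a) {n : ℕ} (hn : n ≠ 0)
    (h : ∀ a, f a ^ n ≤ g a) : avg f ^ n ≤ avg g :=
  (avg_pow_le hf hn).trans (avg_mono h)

/-- The Cauchy–Schwarz inequality, with one factor bounded by one. -/
lemma norm_avg_mul_sq_le {b w : α → ℂ} (hb : ∀ a, ‖b a‖ ≤ 1) :
    ‖avg fun a ↦ b a * w a‖ ^ 2 ≤ avg fun a ↦ ‖w a‖ ^ 2 := by
  calc ‖avg fun a ↦ b a * w a‖ ^ 2 ≤ (avg fun a ↦ ‖w a‖) ^ 2 := by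
        gcongr
        refine (norm_avg_le _).trans (avg_mono fun a ↦ ?_)
        rw [norm_mul]
        exact mul_le_of_le_one_left (norm_nonneg _) (hb a)
    _ ≤ _ := avg_pow_le (fun _ ↦ norm_nonneg _) two_ne_zero

end Average

section GroupAverage

variable {𝕜 : Type*} [RCLike 𝕜] {G : Type*} [AddCommGroup G] [Finite G]

lemma avg_add_right (c : G) (f : G → 𝕜) : avg (fun x ↦ f (x + c)) = avg f :=
  avg_equiv (Equiv.addRight c) f

lemma avg_sub_right (c : G) (f : G → 𝕜) : avg (fun x ↦ f (x - c)) = avg f :=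
  avg_equiv (Equiv.subRight c) f

lemma avg_sub_eq_avg (H : AddSubgroup G) (f : G → 𝕜) :
    avg (fun h : H ↦ avg fun h' : H ↦ f (h - h')) = avg fun h : H ↦ f h := by
  rw [avg_comm, ← avg_const (α := H) (avg fun h : H ↦ f h)]
  congr! 2 with h'
  simpa using avg_sub_right h' fun h : H ↦ f h

/-- Differences of independent uniform elements of two subgroups are uniform on their sum. -/
lemma avg_sub_eq_avg_sup (A B : AddSubgroup G) (f : G → 𝕜) :
    avg (fun a : A ↦ avg fun b : B ↦ f (b - a)) = avg fun c : ↥(A ⊔ B) ↦ f c := by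
  have key (c : ↥(A ⊔ B)) : avg (fun a : A ↦ avg fun b : B ↦ f (c + (b - a))) =
      avg fun a : A ↦ avg fun b : B ↦ f (b - a) := by
    obtain ⟨a₀, ha₀, b₀, hb₀, hc⟩ := AddSubgroup.mem_sup.1 c.2
    rw [← avg_sub_right (⟨a₀, ha₀⟩ : A) fun a : A ↦ avg fun b : B ↦ f (b - a)]
    congr! 2 with a
    rw [← avg_add_right (⟨b₀, hb₀⟩ : B) fun b : B ↦ f (b - _)]
    congr! 3 with b
    simp only [← hc, AddSubgroup.coe_add, AddSubgroup.coe_sub]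
    abel
  have key' (a : A) (b : B) : avg (fun c : ↥(A ⊔ B) ↦ f (c + (b - a))) =
      avg fun c : ↥(A ⊔ B) ↦ f c := by
    have hmem : (b - a : G) ∈ A ⊔ B :=
      sub_mem (AddSubgroup.mem_sup_right b.2) (AddSubgroup.mem_sup_left a.2)
    exact avg_add_right (⟨b - a, hmem⟩ : ↥(A ⊔ B)) fun c ↦ f c
  calc _ = avg fun c : ↥(A ⊔ B) ↦ avg fun a : A ↦ avg fun b : B ↦ f (c + (b - a)) := by
        simp only [key, avg_const]
    _ = avg fun a : A ↦ avg fun b : B ↦ avg fun c : ↥(A ⊔ B) ↦ f (c + (b - a)) := by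
        rw [avg_comm]
        congr! 2
        rw [avg_comm]
    _ = _ := by simp only [key', avg_const]

end GroupAverage

section BoxDifference

variable {ι κ : Type*} [Finite ι] [Finite κ]

lemma epsWt_eq_sum [Fintype ι] (ε : ι → Bool) : epsWt ε = ∑ i, if ε i then 1 else 0 := by
  unfold epsWt
  congr!

lemma epsWt_equiv (e : κ ≃ ι) (ε : ι → Bool) : epsWt (fun j ↦ ε (e j)) = epsWt ε := by
  have := Fintype.ofFinite ι
  have := Fintype.ofFinite κ
  simp only [epsWt_eq_sum]
  exact e.sum_comp fun i ↦ if ε i then 1 else 0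

lemma epsWt_isEmpty [IsEmpty ι] (ε : ι → Bool) : epsWt ε = 0 := by
  have := Fintype.ofFinite ι
  simp [epsWt_eq_sum]

lemma epsWt_option (ε : Option ι → Bool) :
    epsWt ε = (if ε none then 1 else 0) + epsWt fun i ↦ ε (some i) := by
  have := Fintype.ofFinite ι
  simp only [epsWt_eq_sum, Fintype.sum_option]

lemma epsWt_sum (ε : ι ⊕ κ → Bool) :
    epsWt ε = epsWt (fun i ↦ ε (.inl i)) + epsWt fun i ↦ ε (.inr i) := by
  have := Fintype.ofFinite ι
  have := Fintype.ofFinite κ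
  simp only [epsWt_eq_sum, Fintype.sum_sum_type]

lemma epsWt_false : epsWt (fun _ : ι ↦ false) = 0 := by
  have := Fintype.ofFinite ι
  simp [epsWt_eq_sum]

lemma conjIter_zero (z : ℂ) : conjIter 0 z = z := by simp [conjIter]

lemma conjIter_add (m n : ℕ) (z : ℂ) : conjIter (m + n) z = conjIter m (conjIter n z) := by
  by_cases hm : Even m <;> by_cases hn : Even n <;> simp [conjIter, Nat.even_add, hm, hn]

lemma conjIter_one_add (n : ℕ) (z : ℂ) :
    conjIter (1 + n) z = conjIter n ((starRingEnd ℂ) z) := by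
  rw [add_comm, conjIter_add]
  simp [conjIter]

lemma conjIter_mul (n : ℕ) (z w : ℂ) : conjIter n (z * w) = conjIter n z * conjIter n w := by
  by_cases hn : Even n <;> simp [conjIter, hn]

lemma conjIter_prod {α : Type*} (s : Finset α) (n : ℕ) (z : α → ℂ) :
    conjIter n (∏ a ∈ s, z a) = ∏ a ∈ s, conjIter n (z a) := by
  by_cases hn : Even n <;> simp [conjIter, hn]

lemma norm_conjIter (n : ℕ) (z : ℂ) : ‖conjIter n z‖ = ‖z‖ := by
  by_cases hn : Even n <;> simp [conjIter, hn]

variable {G : Type*} [AddCommGroup G]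

/-- The vertex `ε · h` of the box spanned by `h`. -/
def boxShift (ε : ι → Bool) (h : ι → G) : G :=
  haveI := Fintype.ofFinite ι
  ∑ i, if ε i then h i else 0

lemma boxShift_eq_sum [Fintype ι] (ε : ι → Bool) (h : ι → G) :
    boxShift ε h = ∑ i, if ε i then h i else 0 := by
  unfold boxShift
  congr!

lemma boxShift_equiv (e : κ ≃ ι) (ε : ι → Bool) (h : ι → G) :
    boxShift (fun j ↦ ε (e j)) (fun j ↦ h (e j)) = boxShift ε h := by
  have := Fintype.ofFinite ι
  have := Fintype.ofFinite κ
  simp only [boxShift_eq_sum]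
  exact e.sum_comp fun i ↦ if ε i then h i else 0

lemma boxShift_isEmpty [IsEmpty ι] (ε : ι → Bool) (h : ι → G) : boxShift ε h = 0 := by
  have := Fintype.ofFinite ι
  simp [boxShift_eq_sum]

lemma boxShift_false (h : ι → G) : boxShift (fun _ ↦ false) h = 0 := by
  have := Fintype.ofFinite ι
  simp [boxShift_eq_sum]

lemma boxShift_option (ε : Option ι → Bool) (h : Option ι → G) :
    boxShift ε h = (if ε none then h none else 0) +
      boxShift (fun i ↦ ε (some i)) fun i ↦ h (some i) := by
  have := Fintype.ofFinite ι
  simp only [boxShift_eq_sum, Fintype.sum_option]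

lemma boxShift_sum (ε : ι ⊕ κ → Bool) (h : ι ⊕ κ → G) :
    boxShift ε h = boxShift (fun i ↦ ε (.inl i)) (fun i ↦ h (.inl i)) +
      boxShift (fun i ↦ ε (.inr i)) fun i ↦ h (.inr i) := by
  have := Fintype.ofFinite ι
  have := Fintype.ofFinite κ
  simp only [boxShift_eq_sum, Fintype.sum_sum_type]

lemma boxShift_sumElim_false (ε : ι → Bool) (h : ι ⊕ κ → G) :
    boxShift (Sum.elim ε fun _ ↦ false) h = boxShift ε fun i ↦ h (.inl i) := by
  rw [boxShift_sum]
  simp only [Sum.elim_inl, Sum.elim_inr, boxShift_false, add_zero]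

lemma boxShift_sumElim_false_left (ε : κ → Bool) (h : ι ⊕ κ → G) :
    boxShift (Sum.elim (fun _ ↦ false) ε) h = boxShift ε fun i ↦ h (.inr i) := by
  rw [boxShift_sum]
  simp only [Sum.elim_inl, Sum.elim_inr, boxShift_false, zero_add]

/-- The multiplicative derivative of `f` in direction `a`. -/
def mulDiff (a : G) (f : G → ℂ) (x : G) : ℂ := f x * (starRingEnd ℂ) (f (x + a))

/-- The iterated multiplicative derivative of `f` along the box spanned by `h`. -/
def boxDiff (h : ι → G) (f : G → ℂ) (x : G) : ℂ :=
  haveI : Fintype (ι → Bool) := Fintype.ofFinite _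
  ∏ ε : ι → Bool, conjIter (epsWt ε) (f (x + boxShift ε h))

lemma boxDiff_eq_prod [Fintype (ι → Bool)] (h : ι → G) (f : G → ℂ) (x : G) :
    boxDiff h f x = ∏ ε : ι → Bool, conjIter (epsWt ε) (f (x + boxShift ε h)) := by
  unfold boxDiff
  congr!

lemma boxDiff_equiv (e : κ ≃ ι) (h : ι → G) (f : G → ℂ) (x : G) :
    boxDiff (fun j ↦ h (e j)) f x = boxDiff h f x := by
  have := Fintype.ofFinite (ι → Bool)
  have := Fintype.ofFinite (κ → Bool)
  simp only [boxDiff_eq_prod]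
  refine (Fintype.prod_equiv (e.arrowCongr (Equiv.refl Bool)).symm _ _ fun ε ↦ ?_).symm
  rw [← epsWt_equiv e, ← boxShift_equiv e]
  rfl

lemma boxDiff_isEmpty [IsEmpty ι] (h : ι → G) (f : G → ℂ) (x : G) : boxDiff h f x = f x := by
  have := Fintype.ofFinite (ι → Bool)
  simp [boxDiff_eq_prod, epsWt_isEmpty, boxShift_isEmpty, conjIter_zero]

lemma boxDiff_option (h : Option ι → G) (f : G → ℂ) :
    boxDiff h f = boxDiff (fun i ↦ h (some i)) (mulDiff (h none) f) := by
  have := Fintype.ofFinite (ι → Bool)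
  have := Fintype.ofFinite (Option ι → Bool)
  funext x
  simp only [boxDiff_eq_prod]
  rw [Fintype.prod_equiv Equiv.piOptionEquivProd _
    (fun p : Bool × (ι → Bool) ↦ conjIter ((if p.1 then 1 else 0) + epsWt p.2)
      (f (x + ((if p.1 then h none else 0) + boxShift p.2 fun i ↦ h (some i))))) ?_,
    Fintype.prod_prod_type_right]
  · congr! 1 with ε
    simp only [Fintype.prod_bool, if_true, Bool.false_eq_true, if_false, zero_add,
      conjIter_one_add, mulDiff, conjIter_mul, mul_comm]
    congr! 4
    abel
  · intro ε
    rw [epsWt_option, boxShift_option]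
    rfl

lemma boxDiff_sum (h : ι ⊕ κ → G) (f : G → ℂ) :
    boxDiff h f = boxDiff (fun i ↦ h (.inl i)) (boxDiff (fun i ↦ h (.inr i)) f) := by
  have := Fintype.ofFinite (ι → Bool)
  have := Fintype.ofFinite (κ → Bool)
  have := Fintype.ofFinite (ι ⊕ κ → Bool)
  funext x
  simp only [boxDiff_eq_prod, conjIter_prod]
  rw [← Fintype.prod_prod_type']
  refine Fintype.prod_equiv (Equiv.sumArrowEquivProdArrow ι κ Bool) _ _ fun ε ↦ ?_
  rw [← conjIter_add, epsWt_sum, boxShift_sum, add_assoc]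
  rfl

lemma norm_boxDiff_le (h : ι → G) {f : G → ℂ} (hf : ∀ x, ‖f x‖ ≤ 1) (x : G) :
    ‖boxDiff h f x‖ ≤ 1 := by
  have := Fintype.ofFinite (ι → Bool)
  rw [boxDiff_eq_prod, norm_prod]
  exact prod_le_one (fun _ _ ↦ norm_nonneg _) fun ε _ ↦ by rw [norm_conjIter]; exact hf _

lemma norm_mulDiff_le (a : G) {f : G → ℂ} (hf : ∀ x, ‖f x‖ ≤ 1) (x : G) :
    ‖mulDiff a f x‖ ≤ 1 := by
  rw [mulDiff, norm_mul, RCLike.norm_conj]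
  exact mul_le_one₀ (hf _) (norm_nonneg _) (hf _)

lemma mulDiff_mul_prod {S : Type*} [Fintype S] (a : G) (g : G → ℂ) (c : S → G → ℂ)
    (v : S → G) (x : G) :
    mulDiff a (fun x ↦ g x * ∏ l, c l (x + v l)) x =
      mulDiff a g x * ∏ l, mulDiff a (c l) (x + v l) := by
  simp only [mulDiff, map_mul, map_prod, prod_mul_distrib, add_right_comm x a]
  ring

lemma mulDiff_boxDiff (a : G) (h : ι → G) (f : G → ℂ) :
    boxDiff h (mulDiff a f) = mulDiff a (boxDiff h f) := by
  have := Fintype.ofFinite (ι → Bool)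
  funext x
  simp only [mulDiff, boxDiff_eq_prod, conjIter_mul, prod_mul_distrib, map_prod]
  congr! 2 with ε
  rw [add_right_comm]
  by_cases hn : Even (epsWt ε) <;> simp [conjIter, hn]

end BoxDifference

section BoxAverage

variable {G : Type*} [AddCommGroup G] [Finite G] {ι κ : Type*} [Finite ι] [Finite κ]

/-- The box norm `‖f‖_H` raised to the power `2 ^ card ι`, as a complex number. -/
def boxAvg (H : ι → AddSubgroup G) (f : G → ℂ) : ℂ :=
  avg fun k : ∀ i, H i ↦ avg fun x ↦ boxDiff (fun i ↦ (k i : G)) f x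

lemma boxNorm_eq (H : ι → AddSubgroup G) (f : G → ℂ) :
    boxNorm H f = (boxAvg H f).re ^ ((1 : ℝ) / 2 ^ Nat.card ι) := by
  rw [boxAvg, avg_comm]
  simp only [boxNorm, eavg_eq_avg]
  rfl

lemma boxAvg_equiv (e : κ ≃ ι) (H : ι → AddSubgroup G) (f : G → ℂ) :
    boxAvg (fun j ↦ H (e j)) f = boxAvg H f := by
  unfold boxAvg
  rw [← avg_equiv (Equiv.piCongrLeft (fun i ↦ H i) e)]
  congr! 2 with k
  congr! 2 with x
  rw [← boxDiff_equiv e]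
  congr! 2 with j
  simp only [Equiv.piCongrLeft_apply_apply]

lemma boxAvg_isEmpty [IsEmpty ι] (H : ι → AddSubgroup G) (f : G → ℂ) :
    boxAvg H f = avg f := by
  simp only [boxAvg, boxDiff_isEmpty, avg_const]

lemma boxAvg_option (H : Option ι → AddSubgroup G) (f : G → ℂ) :
    boxAvg H f = avg fun h : H none ↦ boxAvg (fun i ↦ H (some i)) (mulDiff (h : G) f) := by
  unfold boxAvg
  rw [← avg_equiv (Equiv.piOptionEquivProd (β := fun i ↦ H i)).symm, avg_prod]
  congr! 6 with h k x
  rw [boxDiff_option]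
  rfl

lemma boxAvg_sum (H : ι ⊕ κ → AddSubgroup G) (f : G → ℂ) :
    boxAvg H f = avg fun b : ∀ j, H (.inr j) ↦
      boxAvg (fun i ↦ H (.inl i)) (boxDiff (fun j ↦ (b j : G)) f) := by
  unfold boxAvg
  rw [← avg_equiv (Equiv.sumPiEquivProdPi (fun i ↦ H i)).symm, avg_prod, avg_comm]
  congr! 6 with b k x
  rw [boxDiff_sum]
  rfl

lemma norm_avg_le_one {α : Type*} [Finite α] {f : α → ℂ} (hf : ∀ a, ‖f a‖ ≤ 1) :
    ‖avg f‖ ≤ 1 := by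
  rcases isEmpty_or_nonempty α with hα | hα
  · have := Fintype.ofFinite α
    simp [avg_eq_expect]
  · exact (norm_avg_le f).trans ((avg_mono hf).trans_eq (avg_const 1))

lemma norm_boxAvg_le (H : ι → AddSubgroup G) {f : G → ℂ} (hf : ∀ x, ‖f x‖ ≤ 1) :
    ‖boxAvg H f‖ ≤ 1 :=
  norm_avg_le_one fun _ ↦ norm_avg_le_one fun x ↦ norm_boxDiff_le _ hf x

lemma avg_norm_avg_sq (H : AddSubgroup G) (F : G → ℂ) :
    ((avg fun x ↦ ‖avg fun k : H ↦ F (x - k)‖ ^ 2 : ℝ) : ℂ) =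
      avg fun h : H ↦ avg fun x ↦ mulDiff (h : G) F x := by
  calc ((avg fun x ↦ ‖avg fun k : H ↦ F (x - k)‖ ^ 2 : ℝ) : ℂ)
      = avg fun x ↦ avg fun k : H ↦ avg fun l : H ↦
          F (x - k) * (starRingEnd ℂ) (F (x - l)) := by
        rw [ofReal_avg]
        congr! 2 with x
        push_cast
        rw [← Complex.mul_conj', conj_avg, avg_mul]
        simp only [mul_avg]
    _ = avg fun k : H ↦ avg fun l : H ↦ avg fun x ↦
          F (x - k) * (starRingEnd ℂ) (F (x - l)) := by
        rw [avg_comm]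
        congr! 2
        rw [avg_comm]
    _ = avg fun k : H ↦ avg fun l : H ↦ avg fun x ↦ mulDiff (k - l : G) F x := by
        congr! 4 with k l
        rw [← avg_add_right (k : G)]
        congr! 2 with x
        simp only [mulDiff]
        congr! 3
        · abel
        · abel
    _ = _ := avg_sub_eq_avg H fun h ↦ avg fun x ↦ mulDiff h F x

lemma boxAvg_option_nonneg (H : Option ι → AddSubgroup G) (f : G → ℂ) :
    boxAvg H f = (‖boxAvg H f‖ : ℂ) := by
  have : boxAvg H f = ((avg fun k : ∀ i, H (some i) ↦
      avg fun x ↦ ‖avg fun h : H none ↦ boxDiff (fun i ↦ (k i : G)) f (x - h)‖ ^ 2 : ℝ) : ℂ) := by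
    rw [boxAvg_option, ofReal_avg]
    simp only [boxAvg]
    rw [avg_comm]
    congr! 2 with k
    rw [avg_norm_avg_sq]
    simp only [mulDiff_boxDiff]
  rw [this, Complex.norm_real, Real.norm_of_nonneg]
  exact avg_nonneg fun _ ↦ avg_nonneg fun _ ↦ by positivity

lemma boxAvg_nonneg [Nonempty ι] (H : ι → AddSubgroup G) (f : G → ℂ) :
    boxAvg H f = (‖boxAvg H f‖ : ℂ) := by
  classical
  have e := Equiv.optionSubtypeNe (Classical.arbitrary ι)
  rw [← boxAvg_equiv e]
  exact boxAvg_option_nonneg _ f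

end BoxAverage

section CauchySchwarz

universe u

variable {G : Type u} [AddCommGroup G] [Finite G]

lemma box_cauchy_schwarz_option {ι : Type} [Finite ι] {Y : Type u} [Finite Y] {S : Type}
    [Fintype S] (H : Option ι → AddSubgroup G) (e : S → Option ι → Bool) (g : Y → G → ℂ)
    (c : Y → S → G → ℂ) (hc : ∀ y l x, ‖c y l x‖ ≤ 1) :
    ‖avg fun y ↦ avg fun k : ∀ i, H i ↦ avg fun x ↦
        g y x * ∏ l, c y l (x + boxShift (e l) fun i ↦ (k i : G))‖ ^ 2 ≤
      ‖avg fun p : Y × H none ↦ avg fun k : ∀ i, H (some i) ↦ avg fun x ↦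
        mulDiff (p.2 : G) (g p.1) x * ∏ l : {l // ¬ e l none},
          mulDiff (p.2 : G) (c p.1 l) (x + boxShift (fun i ↦ e l (some i)) fun i ↦ (k i : G))‖ := by
  let F (y : Y) (k : ∀ i, H (some i)) (x : G) : ℂ := g y x * ∏ l : {l // ¬ e l none},
    c y l (x + boxShift (fun i ↦ e l (some i)) fun i ↦ (k i : G))
  let b (a : Y × (∀ i, H (some i)) × G) : ℂ := ∏ l : {l // e l none},
    c a.1 l (a.2.2 + boxShift (fun i ↦ e l (some i)) fun i ↦ (a.2.1 i : G))
  have hb (a) : ‖b a‖ ≤ 1 := by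
    rw [norm_prod]
    exact prod_le_one (fun _ _ ↦ norm_nonneg _) fun l _ ↦ hc _ _ _
  let w (a : Y × (∀ i, H (some i)) × G) : ℂ := avg fun h : H none ↦ F a.1 a.2.1 (a.2.2 - h)
  have h₁ : (avg fun y ↦ avg fun k : ∀ i, H i ↦ avg fun x ↦
      g y x * ∏ l, c y l (x + boxShift (e l) fun i ↦ (k i : G))) = avg fun a ↦ b a * w a := by
    rw [avg_prod]
    congr! 2 with y
    rw [← avg_equiv (Equiv.piOptionEquivProd (β := fun i ↦ H i)).symm, avg_prod, avg_prod,
      avg_comm]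
    congr! 2 with k
    simp only [w, mul_avg]
    rw [avg_comm]
    nth_rewrite 2 [avg_comm]
    rw [avg_comm]
    congr! 2 with h
    rw [← avg_sub_right (h : G)]
    congr! 2 with x
    have hs (l : S) : boxShift (e l)
        (fun i ↦ (((Equiv.piOptionEquivProd (β := fun i ↦ H i)).symm (h, k) i : H i) : G)) =
          (if e l none then (h : G) else 0) + boxShift (fun i ↦ e l (some i)) fun i ↦ (k i : G) :=
      boxShift_option _ _
    rw [← Fintype.prod_subtype_mul_prod_subtype (fun l ↦ e l none = true)]
    simp only [F, b, hs]
    rw [mul_left_comm]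
    congr 1
    · refine prod_congr rfl fun l _ ↦ ?_
      rw [if_pos l.2, ← add_assoc, sub_add_cancel]
    · congr 1
      refine prod_congr rfl fun l _ ↦ ?_
      rw [if_neg l.2, zero_add]
  have h₂ : ((avg fun a ↦ ‖w a‖ ^ 2 : ℝ) : ℂ) =
      avg fun p : Y × H none ↦ avg fun k : ∀ i, H (some i) ↦ avg fun x ↦
        mulDiff (p.2 : G) (g p.1) x * ∏ l : {l // ¬ e l none},
          mulDiff (p.2 : G) (c p.1 l)
            (x + boxShift (fun i ↦ e l (some i)) fun i ↦ (k i : G)) := by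
    rw [avg_prod, ofReal_avg, avg_prod]
    congr! 2 with y
    rw [avg_prod, ofReal_avg, avg_comm]
    congr! 2 with k
    exact (avg_norm_avg_sq (H none) (F y k)).trans (by simp only [F, mulDiff_mul_prod])
  rw [h₁, ← h₂, Complex.norm_real]
  exact (norm_avg_mul_sq_le hb).trans (le_abs_self _)

/-- The Cauchy–Schwarz inequality for box norms: an average of `g` against bounded functions, each
of which depends on some nontrivial vertex of the box, is controlled by the box norm of `g`. -/
lemma box_cauchy_schwarz {ι : Type} [Finite ι] : ∀ {Y : Type u} [Finite Y] {S : Type}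
    [Fintype S] (H : ι → AddSubgroup G) (e : S → ι → Bool) (_ : ∀ l, ∃ j, e l j = true)
    (g : Y → G → ℂ) (c : Y → S → G → ℂ) (_ : ∀ y l x, ‖c y l x‖ ≤ 1),
    ‖avg fun y ↦ avg fun k : ∀ i, H i ↦ avg fun x ↦
        g y x * ∏ l, c y l (x + boxShift (e l) fun i ↦ (k i : G))‖ ^ 2 ^ Nat.card ι ≤
      ‖avg fun y ↦ boxAvg H (g y)‖ := by
  refine Finite.induction_empty_option (P := fun ι ↦ ∀ [Finite ι] {Y : Type u} [Finite Y] {S : Type}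
    [Fintype S] (H : ι → AddSubgroup G) (e : S → ι → Bool) (_ : ∀ l, ∃ j, e l j = true)
    (g : Y → G → ℂ) (c : Y → S → G → ℂ) (_ : ∀ y l x, ‖c y l x‖ ≤ 1),
    ‖avg fun y ↦ avg fun k : ∀ i, H i ↦ avg fun x ↦
        g y x * ∏ l, c y l (x + boxShift (e l) fun i ↦ (k i : G))‖ ^ 2 ^ Nat.card ι ≤
      ‖avg fun y ↦ boxAvg H (g y)‖) ?_ ?_ ?_ ι
  · intro α β r ih _ Y _ S _ H e he g c hc
    have := Finite.of_equiv β r.symm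
    convert ih (fun i ↦ H (r i)) (fun l i ↦ e l (r i))
      (fun l ↦ let ⟨j, hj⟩ := he l; ⟨r.symm j, by simpa using hj⟩) g c hc using 2
    · congr! 3 with y
      rw [← avg_equiv (Equiv.piCongrLeft (fun i ↦ H i) r)]
      congr! 2 with k
      congr! 5 with x _ l
      rw [← boxShift_equiv r]
      congr! 2 with i
      simp only [Equiv.piCongrLeft_apply_apply]
    · rw [Nat.card_congr r]
    · simp only [boxAvg_equiv]
  · intro _ Y _ S _ H e he g c hc
    have : IsEmpty S := ⟨fun l ↦ (he l).elim fun j ↦ j.elim⟩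
    simp only [boxAvg, boxDiff_isEmpty, univ_eq_empty, prod_empty, mul_one, Nat.card_of_isEmpty,
      pow_zero, pow_one, le_refl]
  · intro ι _ ih _ Y _ S _ H e he g c hc
    rw [Finite.card_option, pow_succ', pow_mul]
    refine (pow_le_pow_left₀ (by positivity) (box_cauchy_schwarz_option H e g c hc) _).trans ?_
    have he' (l : {l // ¬ e l none}) : ∃ j, e l (some j) = true := by
      obtain ⟨_ | j, hj⟩ := he l
      · exact absurd hj l.2
      · exact ⟨j, hj⟩
    have key := ih (Y := Y × H none) (fun i ↦ H (some i))
      (fun (l : {l // ¬ e l none}) i ↦ e l (some i)) he'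
      (fun p ↦ mulDiff (p.2 : G) (g p.1)) (fun p l ↦ mulDiff (p.2 : G) (c p.1 l))
      fun p l ↦ norm_mulDiff_le _ (hc _ _)
    rw [avg_prod (fun p : Y × H none ↦
      boxAvg (fun i ↦ H (some i)) (mulDiff (p.2 : G) (g p.1)))] at key
    simp only [boxAvg_option]
    exact key

/-- Box norms increase when subgroups are added to the family. -/
lemma norm_boxAvg_pow_le {ι κ : Type} [Finite ι] [Finite κ] {H : ι → AddSubgroup G}
    {K : κ → AddSubgroup G} (φ : ι ↪ κ) (h : ∀ i, K (φ i) = H i) (f : G → ℂ) :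
    ‖boxAvg H f‖ ^ 2 ^ (Nat.card κ - Nat.card ι) ≤ ‖boxAvg K f‖ := by
  classical
  let e : {k // k ∉ Set.range φ} ⊕ ι ≃ κ := (Equiv.sumComm _ _).trans <|
    ((Equiv.ofInjective φ φ.injective).sumCongr (Equiv.refl _)).trans
      (Equiv.sumCompl (· ∈ Set.range φ))
  have hcard : Nat.card {k // k ∉ Set.range φ} = Nat.card κ - Nat.card ι := by
    rw [← Nat.card_congr e, Nat.card_sum, Nat.add_sub_cancel]
  have hH : H = fun i ↦ K (e (.inr i)) := funext fun i ↦ (h i).symm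
  have key := box_cauchy_schwarz (Y := ∀ i, K (e (.inr i))) (S := Empty)
    (fun r ↦ K (e (.inl r))) (fun l ↦ l.elim) (fun l ↦ l.elim)
    (fun y ↦ boxDiff (fun i ↦ (y i : G)) f) (fun _ l ↦ l.elim) (fun _ l ↦ l.elim)
  simp only [univ_eq_empty, prod_empty, mul_one, avg_const] at key
  rw [← boxAvg_equiv e, boxAvg_sum, ← hcard, hH]
  exact key

end CauchySchwarz

section Doubling

universe u

variable {G : Type u} [AddCommGroup G] {κ : Type} [Finite κ]

/-- The nonzero vertices of the Boolean cube. -/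
abbrev NonzeroVertex (κ : Type) : Type := {ε : κ → Bool // ∃ j, ε j = true}

lemma boxDiff_eq_mul [Fintype (NonzeroVertex κ)] (k : κ → G) (f : G → ℂ) (x : G) :
    boxDiff k f x =
      f x * ∏ ε : NonzeroVertex κ, conjIter (epsWt ε.1) (f (x + boxShift ε.1 k)) := by
  classical
  have hfin := Fintype.ofFinite (κ → Bool)
  let hunique : Unique {ε : κ → Bool // ¬ ∃ j, ε j = true} :=
    { default := ⟨fun _ ↦ false, by simp⟩
      uniq := fun ε ↦ Subtype.ext <| funext fun j ↦ by simpa using not_exists.1 ε.2 j }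
  rw [boxDiff_eq_prod, ← Fintype.prod_subtype_mul_prod_subtype (fun ε : κ → Bool ↦ ∃ j, ε j = true),
    mul_comm]
  congr 1
  · rw [Fintype.prod_unique]
    change conjIter (epsWt fun _ : κ ↦ false) (f (x + boxShift (fun _ ↦ false) k)) = _
    rw [epsWt_false, boxShift_false, conjIter_zero, add_zero]
  · congr!

/-- The integrand of the function dual to `f` with respect to the box with sides `h` and `k`. -/
def dualTerm (f : G → ℂ) (h : G) (k : κ → G) (x : G) : ℂ :=
  haveI : Fintype (NonzeroVertex κ) := Fintype.ofFinite _
  (starRingEnd ℂ) (f (x + h)) *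
    ∏ ε : NonzeroVertex κ, conjIter (epsWt ε.1) (mulDiff h f (x + boxShift ε.1 k))

lemma dualTerm_eq [Fintype (NonzeroVertex κ)] (f : G → ℂ) (h : G) (k : κ → G) (x : G) :
    dualTerm f h k x = (starRingEnd ℂ) (f (x + h)) *
      ∏ ε : NonzeroVertex κ, conjIter (epsWt ε.1) (mulDiff h f (x + boxShift ε.1 k)) := by
  unfold dualTerm
  congr!

lemma boxDiff_mulDiff_eq_mul (h : G) (k : κ → G) (f : G → ℂ) (x : G) :
    boxDiff k (mulDiff h f) x = f x * dualTerm f h k x := by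
  have := Fintype.ofFinite (NonzeroVertex κ)
  rw [boxDiff_eq_mul, dualTerm_eq, ← mul_assoc]
  rfl

lemma avg_norm_avg_sq_le {α β : Type*} [Finite α] [Finite β] (W : β → α → ℂ) :
    (avg fun a ↦ ‖avg fun i ↦ W i a‖ ^ 2) ≤
      avg fun i ↦ avg fun j ↦ ‖avg fun a ↦ (starRingEnd ℂ) (W i a) * W j a‖ := by
  have : ((avg fun a ↦ ‖avg fun i ↦ W i a‖ ^ 2 : ℝ) : ℂ) =
      avg fun i ↦ avg fun j ↦ avg fun a ↦ (starRingEnd ℂ) (W i a) * W j a := by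
    rw [ofReal_avg]
    calc _ = avg fun a ↦ avg fun i ↦ avg fun j ↦ (starRingEnd ℂ) (W i a) * W j a := by
          congr! 2 with a
          push_cast
          rw [← Complex.conj_mul', conj_avg, avg_mul]
          simp only [mul_avg]
      _ = _ := by
          rw [avg_comm]
          congr! 2
          rw [avg_comm]
  rw [← Real.norm_of_nonneg (avg_nonneg fun a ↦ sq_nonneg ‖avg fun i ↦ W i a‖),
    ← Complex.norm_real, this]
  exact (norm_avg_le _).trans (avg_mono fun i ↦ norm_avg_le _)

variable [Finite G]

lemma norm_avg_dualTerm_pow_le (A B : AddSubgroup G) (K L : κ → AddSubgroup G) {f : G → ℂ}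
    (hf : ∀ x, ‖f x‖ ≤ 1) :
    ‖avg fun x ↦
        (starRingEnd ℂ)
          (avg fun h : A ↦ avg fun k : ∀ j, K j ↦ dualTerm f h (fun j ↦ (k j : G)) x) *
          avg fun h : B ↦ avg fun k : ∀ j, L j ↦ dualTerm f h (fun j ↦ (k j : G)) x‖ ^
        2 ^ Nat.card (κ ⊕ κ) ≤
      ‖boxAvg (fun o : Option (κ ⊕ κ) ↦ o.elim (A ⊔ B) (Sum.elim K L)) f‖ := by
  have := Fintype.ofFinite (NonzeroVertex κ)
  have key := box_cauchy_schwarz (Y := A × B) (S := NonzeroVertex κ ⊕ NonzeroVertex κ)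
    (Sum.elim K L)
    (Sum.elim (fun ε ↦ Sum.elim ε.1 fun _ ↦ false) fun ε ↦ Sum.elim (fun _ ↦ false) ε.1)
    (by
      rintro (⟨ε, j, hj⟩ | ⟨ε, j, hj⟩)
      exacts [⟨.inl j, hj⟩, ⟨.inr j, hj⟩])
    (fun y ↦ mulDiff (y.2 - y.1 : G) f)
    (fun y ↦ Sum.elim
      (fun ε z ↦ (starRingEnd ℂ) (conjIter (epsWt ε.1) (mulDiff (y.1 : G) f (z - y.1))))
      fun ε z ↦ conjIter (epsWt ε.1) (mulDiff (y.2 : G) f (z - y.1)))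
    (by
      rintro y (ε | ε) x <;>
      simp only [Sum.elim_inl, Sum.elim_inr, RCLike.norm_conj, norm_conjIter, norm_mulDiff_le _ hf])
  rw [avg_prod, avg_prod,
    avg_sub_eq_avg_sup A B fun c ↦ boxAvg (Sum.elim K L) (mulDiff c f)] at key
  rw [boxAvg_option]
  refine Eq.trans_le ?_ key
  congr 2
  calc _ = avg fun h : A ↦ avg fun k : ∀ j, K j ↦ avg fun h' : B ↦ avg fun k' : ∀ j, L j ↦
        avg fun x ↦ (starRingEnd ℂ) (dualTerm f h (fun j ↦ (k j : G)) x) *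
          dualTerm f h' (fun j ↦ (k' j : G)) x := by
        simp only [conj_avg, avg_mul]
        rw [avg_comm]; congr! 2 with h
        rw [avg_comm]; congr! 2 with k
        simp only [mul_avg]
        rw [avg_comm]; congr! 2 with h'
        rw [avg_comm]
    _ = _ := by
        congr! 2 with h
        rw [avg_comm]
        congr! 2 with h'
        rw [← avg_equiv (Equiv.sumPiEquivProdPi fun i ↦ ↥(Sum.elim K L i)).symm
          fun k ↦ avg fun x ↦ _, avg_prod]
        refine congrArg avg (funext fun (k : ∀ j, K j) ↦ congrArg avg (funext fun k' ↦ ?_))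
        rw [← avg_sub_right (h : G)]
        congr! 2 with x
        rw [Fintype.prod_sum_type]
        simp only [Sum.elim_inl, Sum.elim_inr, boxShift_sumElim_false, boxShift_sumElim_false_left]
        simp only [dualTerm_eq, map_mul, map_prod, Complex.conj_conj, sub_add_cancel,
          add_sub_right_comm]
        rw [mul_mul_mul_comm, sub_add_comm, add_comm (h' - h : G) x]
        rfl

lemma norm_avg_boxAvg_pow_le {I : Type*} [Finite I] (A : I → AddSubgroup G)
    (K : I → κ → AddSubgroup G) {f : G → ℂ} (hf : ∀ x, ‖f x‖ ≤ 1) :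
    ‖avg fun i ↦ boxAvg (fun o : Option κ ↦ o.elim (A i) (K i)) f‖ ^
        (2 * 2 ^ Nat.card (κ ⊕ κ)) ≤
      avg fun i ↦ avg fun j ↦
        ‖boxAvg (fun o : Option (κ ⊕ κ) ↦ o.elim (A i ⊔ A j) (Sum.elim (K i) (K j))) f‖ := by
  let W (i : I) (x : G) : ℂ :=
    avg fun h : A i ↦ avg fun k : ∀ j, K i j ↦ dualTerm f h (fun j ↦ (k j : G)) x
  have hW : (avg fun i ↦ boxAvg (fun o : Option κ ↦ o.elim (A i) (K i)) f) =
      avg fun x ↦ f x * avg fun i ↦ W i x := by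
    simp only [mul_avg]
    rw [avg_comm]
    congr! 2 with i
    rw [boxAvg_option]
    simp only [W, boxAvg, mul_avg, Option.elim_none, Option.elim_some]
    rw [avg_comm]
    congr! 2 with h
    rw [avg_comm]
    congr! 4 with k x
    exact boxDiff_mulDiff_eq_mul _ _ _ _
  have hsq := (norm_avg_mul_sq_le hf (w := fun x ↦ avg fun i ↦ W i x)).trans
    (avg_norm_avg_sq_le W)
  rw [← hW] at hsq
  have hn : 2 ^ Nat.card (κ ⊕ κ) ≠ 0 := by positivity
  rw [pow_mul]
  calc _ ≤ (avg fun i ↦ avg fun j ↦ ‖avg fun x ↦ (starRingEnd ℂ) (W i x) * W j x‖) ^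
        2 ^ Nat.card (κ ⊕ κ) := by gcongr
    _ ≤ avg fun i ↦ avg fun j ↦ ‖avg fun x ↦ (starRingEnd ℂ) (W i x) * W j x‖ ^
        2 ^ Nat.card (κ ⊕ κ) :=
        (avg_pow_le (fun _ ↦ avg_nonneg fun _ ↦ norm_nonneg _) hn).trans <|
          avg_mono fun _ ↦ avg_pow_le (fun _ ↦ norm_nonneg _) hn
    _ ≤ _ := avg_mono fun i ↦ avg_mono fun j ↦
        norm_avg_dualTerm_pow_le (A i) (A j) (K i) (K j) hf

/-- On average over `i`, the box norm along `A i`, `K i` and `B` is controlled by the average over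
pairs `(i, j)` of the box norms along `A i ⊔ A j`, `K i`, `K j` and `B`. -/
lemma avg_norm_boxAvg_pow_le {I : Type*} [Finite I] {β : Type} [Finite β] (A : I → AddSubgroup G)
    (K : I → κ → AddSubgroup G) (B : β → AddSubgroup G) {f : G → ℂ} (hf : ∀ x, ‖f x‖ ≤ 1) :
    (avg fun i ↦ ‖boxAvg (Sum.elim (fun o : Option κ ↦ o.elim (A i) (K i)) B) f‖) ^
        (2 * 2 ^ Nat.card (κ ⊕ κ)) ≤
      avg fun i ↦ avg fun j ↦ ‖boxAvg (Sum.elim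
        (fun o : Option (κ ⊕ κ) ↦ o.elim (A i ⊔ A j) (Sum.elim (K i) (K j))) B) f‖ := by
  rw [avg_norm_eq fun i ↦ boxAvg_nonneg
    (Sum.elim (fun o : Option κ ↦ o.elim (A i) (K i)) B) f]
  simp only [boxAvg_sum, Sum.elim_inl, Sum.elim_inr]
  rw [avg_comm fun (i : I) (b : ∀ j, B j) ↦
    boxAvg (fun o : Option κ ↦ o.elim (A i) (K i)) (boxDiff (fun j ↦ (b j : G)) f)]
  calc _ ≤ (avg fun b : ∀ j, B j ↦ ‖avg fun i ↦ boxAvg (fun o : Option κ ↦ o.elim (A i) (K i))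
          (boxDiff (fun j ↦ (b j : G)) f)‖) ^ (2 * 2 ^ Nat.card (κ ⊕ κ)) := by
        gcongr
        exact norm_avg_le _
    _ ≤ avg fun b : ∀ j, B j ↦ ‖avg fun i ↦ boxAvg (fun o : Option κ ↦ o.elim (A i) (K i))
          (boxDiff (fun j ↦ (b j : G)) f)‖ ^ (2 * 2 ^ Nat.card (κ ⊕ κ)) :=
        avg_pow_le (fun _ ↦ norm_nonneg _) (by positivity)
    _ ≤ avg fun b : ∀ j, B j ↦ avg fun i ↦ avg fun j ↦
          ‖boxAvg (fun o : Option (κ ⊕ κ) ↦ o.elim (A i ⊔ A j) (Sum.elim (K i) (K j)))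
            (boxDiff (fun j ↦ (b j : G)) f)‖ :=
        avg_mono fun b ↦ norm_avg_boxAvg_pow_le A K fun x ↦ norm_boxDiff_le _ hf x
    _ = _ := by
        refine (avg_comm _).trans ?_
        congr! 2 with i
        refine (avg_comm _).trans ?_
        congr! 2 with j
        exact avg_norm_eq fun b ↦ boxAvg_nonneg _ _

end Doubling

section Concatenation

universe u w

variable {s : ℕ} {V : Type}

/-- Indices for sums of pairs of subgroups: the `j`-th subgroups at two vertices of `V` are summed,
where a vertex `v` is paired with itself only if `j ∈ D v`. -/
abbrev PairIndex (D : V → Finset (Fin s)) : Type :=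
  {q : Fin s × V × V // q.2.1 ≠ q.2.2 ∨ q.1 ∈ D q.2.1}

variable {G : Type u} [AddCommGroup G] {I : Type w}

/-- The sums of pairs of subgroups indexed by `PairIndex D`. -/
def pairFamily (D : V → Finset (Fin s)) (H : I → Fin s → AddSubgroup G) (i : V → I)
    (q : PairIndex D) : AddSubgroup G :=
  H (i q.1.2.1) q.1.1 ⊔ H (i q.1.2.2) q.1.1

/-- Averaged box norm of `f` along the families `pairFamily D H i`. -/
def pairAvg [Finite V] [Finite G] [Finite I] (D : V → Finset (Fin s))
    (H : I → Fin s → AddSubgroup G) (f : G → ℂ) : ℝ :=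
  avg fun i : V → I ↦ ‖boxAvg (pairFamily D H i) f‖

/-- Duplicate the vertex `a`, removing `j` from the diagonal at both copies. -/
def splitVertex [DecidableEq V] (D : V → Finset (Fin s)) (a : V) (j : Fin s) (o : Option V) :
    Finset (Fin s) :=
  o.elim ((D a).erase j) (Function.update D a ((D a).erase j))

section Split

variable [DecidableEq V] (D : V → Finset (Fin s)) (a : V) (j : Fin s)

/-- The indices in `PairIndex D` involving `a`, except for `(j, a, a)`. -/
abbrev TouchingIndex : Type :=
  {q : Fin s × V × V // (q.2.1 = a ∨ q.2.2 = a) ∧ q ≠ (j, a, a) ∧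
    (q.2.1 ≠ q.2.2 ∨ q.1 ∈ D q.2.1)}

/-- The indices in `PairIndex D` not involving `a`. -/
abbrev AvoidingIndex : Type :=
  {q : Fin s × V × V // (q.2.1 ≠ a ∧ q.2.2 ≠ a) ∧ (q.2.1 ≠ q.2.2 ∨ q.1 ∈ D q.2.1)}

/-- Splitting `PairIndex D` according to the role of `a`. -/
def pairIndexEmbedding : PairIndex D ↪ Option (TouchingIndex D a j) ⊕ AvoidingIndex D a where
  toFun q :=
    if h : q.1.2.1 = a ∨ q.1.2.2 = a then
      .inl (if h' : q.1 = (j, a, a) then none else some ⟨q.1, h, h', q.2⟩)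
    else .inr ⟨q.1, not_or.1 h, q.2⟩
  inj' q q' h := by
    apply Subtype.ext
    dsimp only at h
    split_ifs at h <;> simp_all

/-- Rename the vertex `a` to `none`. -/
def toNone (v : V) : Option V := if v = a then none else some v

lemma toNone_injective : Function.Injective (toNone a) := by
  intro v v' h
  unfold toNone at h
  split_ifs at h <;> simp_all

/-- The indices arising from doubling at `a` as indices over `Option V`. -/
def splitIndexEmbedding :
    Option (TouchingIndex D a j ⊕ TouchingIndex D a j) ⊕ AvoidingIndex D a ↪
      PairIndex (splitVertex D a j) where
  toFun
    | .inl none => ⟨(j, some a, none), .inl (by simp)⟩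
    | .inl (some (.inl q)) => ⟨(q.1.1, some q.1.2.1, some q.1.2.2), by
        obtain ⟨⟨l, v, v'⟩, h, h', h''⟩ := q
        by_cases hv : v = v'
        · subst hv
          simp only [or_self, ne_eq, not_true_eq_false, false_or] at h h''
          subst h
          have : l ≠ j := fun hl ↦ h' (by rw [hl])
          exact .inr (by simp [splitVertex, this, h''])
        · exact .inl (by simpa using hv)⟩
    | .inl (some (.inr q)) => ⟨(q.1.1, toNone a q.1.2.1, toNone a q.1.2.2), by
        obtain ⟨⟨l, v, v'⟩, h, h', h''⟩ := q
        by_cases hv : v = v'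
        · subst hv
          simp only [or_self, ne_eq, not_true_eq_false, false_or] at h h''
          subst h
          have : l ≠ j := fun hl ↦ h' (by rw [hl])
          exact .inr (by simp [splitVertex, toNone, this, h''])
        · exact .inl ((toNone_injective a).ne hv)⟩
    | .inr q => ⟨(q.1.1, some q.1.2.1, some q.1.2.2), by
        obtain ⟨⟨l, v, v'⟩, h, h''⟩ := q
        simp_all [splitVertex]⟩
  inj' := by
    rintro ((_ | q | q) | q) ((_ | q' | q') | q') h <;>
      simp only [Subtype.mk.injEq, Prod.mk.injEq, toNone] at h <;>
      grind

variable [Finite V] [Finite G] [Finite I]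

variable {D} in
lemma exists_pairAvg_pow_le_split : ∃ n : ℕ, n ≠ 0 ∧
    ∀ (G : Type u) [AddCommGroup G] [Finite G] (I : Type w) [Finite I]
      (H : I → Fin s → AddSubgroup G) (f : G → ℂ), (∀ x, ‖f x‖ ≤ 1) →
      pairAvg D H f ^ n ≤ pairAvg (splitVertex D a j) H f := by
  let Θ := TouchingIndex D a j
  let Ξ := AvoidingIndex D a
  let n₁ := 2 ^ (Nat.card (Option Θ ⊕ Ξ) - Nat.card (PairIndex D))
  let n₂ := 2 * 2 ^ Nat.card (Θ ⊕ Θ)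
  let n₃ := 2 ^ (Nat.card (PairIndex (splitVertex D a j)) - Nat.card (Option (Θ ⊕ Θ) ⊕ Ξ))
  have hn₁ : n₁ ≠ 0 := by positivity
  have hn₂ : n₂ ≠ 0 := by positivity
  have hn₃ : n₃ ≠ 0 := by positivity
  refine ⟨n₁ * (n₂ * n₃), by positivity, fun G _ _ I _ H f hf ↦ ?_⟩
  let u (r : {v // v ≠ a} → I) (i : I) : V → I := (Equiv.funSplitAt a I).symm (i, r)
  have hu (r i) : u r i a = i := by simp [u, Equiv.funSplitAt]
  have hu' (r i) (v : V) (hv : v ≠ a) : u r i v = r ⟨v, hv⟩ := by simp [u, Equiv.funSplitAt, hv]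
  let K (r i) (q : Θ) : AddSubgroup G := H (u r i q.1.2.1) q.1.1 ⊔ H (u r i q.1.2.2) q.1.1
  let B (r : {v // v ≠ a} → I) (q : Ξ) : AddSubgroup G :=
    H (r ⟨q.1.2.1, q.2.1.1⟩) q.1.1 ⊔ H (r ⟨q.1.2.2, q.2.1.2⟩) q.1.1
  let F₁ (r i) : ℝ :=
    ‖boxAvg (Sum.elim (fun o : Option Θ ↦ o.elim (H i j) (K r i)) (B r)) f‖
  let F₂ (r i i') : ℝ := ‖boxAvg (Sum.elim
    (fun o : Option (Θ ⊕ Θ) ↦ o.elim (H i j ⊔ H i' j) (Sum.elim (K r i) (K r i'))) (B r)) f‖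
  have h₁ (r i) : ‖boxAvg (pairFamily D H (u r i)) f‖ ^ n₁ ≤ F₁ r i := by
    refine norm_boxAvg_pow_le (pairIndexEmbedding D a j) (fun q ↦ ?_) f
    have hq : pairIndexEmbedding D a j q =
      if h : q.1.2.1 = a ∨ q.1.2.2 = a then
        .inl (if h' : q.1 = (j, a, a) then none else some ⟨q.1, h, h', q.2⟩)
      else .inr ⟨q.1, not_or.1 h, q.2⟩ := rfl
    rw [hq]
    split_ifs with h h'
    · simp [pairFamily, h', hu]
    · rfl
    · obtain ⟨h, h'⟩ := not_or.1 h
      simp [pairFamily, B, hu' _ _ _ h, hu' _ _ _ h']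
  have h₂ (r) : (avg fun i ↦ F₁ r i) ^ n₂ ≤ avg fun i ↦ avg fun i' ↦ F₂ r i i' :=
    avg_norm_boxAvg_pow_le (fun i ↦ H i j) (K r) (B r) hf
  have h₃ (r i i') : F₂ r i i' ^ n₃ ≤
      ‖boxAvg (pairFamily (splitVertex D a j) H fun o ↦ o.elim i' (u r i)) f‖ := by
    have hτ (v : V) : (toNone a v).elim i' (u r i) = u r i' v := by
      unfold toNone
      split_ifs with h
      · rw [h, hu]
        rfl
      · simp [hu' _ _ _ h]
    refine norm_boxAvg_pow_le (splitIndexEmbedding D a j) (fun q ↦ ?_) f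
    rcases q with (_ | q | q) | q
    · change H (u r i a) j ⊔ H i' j = H i j ⊔ H i' j
      rw [hu]
    · rfl
    · change H ((toNone a q.1.2.1).elim i' (u r i)) q.1.1 ⊔
        H ((toNone a q.1.2.2).elim i' (u r i)) q.1.1 =
          H (u r i' q.1.2.1) q.1.1 ⊔ H (u r i' q.1.2.2) q.1.1
      rw [hτ, hτ]
    · change H (u r i q.1.2.1) q.1.1 ⊔ H (u r i q.1.2.2) q.1.1 =
        H (r ⟨q.1.2.1, q.2.1.1⟩) q.1.1 ⊔ H (r ⟨q.1.2.2, q.2.1.2⟩) q.1.1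
      rw [hu' _ _ _ q.2.1.1, hu' _ _ _ q.2.1.2]
  have e₁ : pairAvg D H f = avg fun r ↦ avg fun i ↦ ‖boxAvg (pairFamily D H (u r i)) f‖ := by
    rw [pairAvg, ← avg_equiv (Equiv.funSplitAt a I).symm, avg_prod, avg_comm]
  have e₃ : pairAvg (splitVertex D a j) H f = avg fun r ↦ avg fun i ↦ avg fun i' ↦
      ‖boxAvg (pairFamily (splitVertex D a j) H fun o ↦ o.elim i' (u r i)) f‖ := by
    have hsymm (i' : I) (v : V → I) :
        (Equiv.piOptionEquivProd (β := fun _ ↦ I)).symm (i', v) = fun o ↦ o.elim i' v := by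
      funext o
      cases o <;> rfl
    rw [pairAvg, ← avg_equiv (Equiv.piOptionEquivProd (β := fun _ : Option V ↦ I)).symm, avg_prod]
    simp only [hsymm]
    calc _ = avg fun v : V → I ↦ avg fun i' ↦
          ‖boxAvg (pairFamily (splitVertex D a j) H fun o ↦ o.elim i' v) f‖ := avg_comm _
      _ = _ := by
          rw [← avg_equiv (Equiv.funSplitAt a I).symm, avg_prod]
          exact avg_comm _
  rw [e₁, e₃, pow_mul, pow_mul]
  have hF₁ (r) : 0 ≤ avg fun i ↦ F₁ r i := avg_nonneg fun _ ↦ norm_nonneg _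
  have hF₂ (r i) : 0 ≤ avg fun i' ↦ F₂ r i i' := avg_nonneg fun _ ↦ norm_nonneg _
  have hF₂' (r) : 0 ≤ avg fun i ↦ avg fun i' ↦ F₂ r i i' := avg_nonneg fun _ ↦ hF₂ _ _
  have hF₀ (r) : 0 ≤ avg fun i ↦ ‖boxAvg (pairFamily D H (u r i)) f‖ :=
    avg_nonneg fun _ ↦ norm_nonneg _
  have p₁ := avg_pow_le_avg hF₀ hn₁ fun r ↦ avg_pow_le_avg (fun _ ↦ norm_nonneg _) hn₁ (h₁ r)
  have p₂ := avg_pow_le_avg hF₁ hn₂ h₂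
  have p₃ := avg_pow_le_avg hF₂' hn₃ fun r ↦ avg_pow_le_avg (hF₂ r) hn₃ fun i ↦
    avg_pow_le_avg (fun _ ↦ norm_nonneg _) hn₃ (h₃ r i)
  refine (pow_le_pow_left₀ ?_ (pow_le_pow_left₀ ?_ p₁ n₂) n₃).trans <|
    (pow_le_pow_left₀ ?_ p₂ n₃).trans p₃
  · exact pow_nonneg (pow_nonneg (avg_nonneg hF₀) _) _
  · exact pow_nonneg (avg_nonneg hF₀) _
  · exact pow_nonneg (avg_nonneg hF₁) _

end Split

lemma sum_two_pow_card_splitVertex [Fintype V] [DecidableEq V] {D : V → Finset (Fin s)} {a : V}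
    {j : Fin s} (hj : j ∈ D a) :
    ∑ o, 2 ^ #(splitVertex D a j o) = ∑ v, 2 ^ #(D v) := by
  have h₁ : ∑ v, 2 ^ #(Function.update D a ((D a).erase j) v) =
      2 ^ #((D a).erase j) + ∑ v ∈ univ \ {a}, 2 ^ #(D v) := by
    simp only [Function.apply_update (fun _ (A : Finset (Fin s)) ↦ 2 ^ #A)]
    exact sum_update_of_mem (mem_univ a) _ _
  rw [Fintype.sum_option]
  simp only [splitVertex, Option.elim_none, Option.elim_some]
  rw [h₁, ← add_assoc, ← two_mul, ← pow_succ', card_erase_add_one hj,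
    ← sum_eq_add_sum_sdiff_singleton_of_mem (mem_univ a) fun v ↦ 2 ^ #(D v)]

variable [Finite G] [Finite I]

lemma pairAvg_equiv {W : Type} [Finite V] [Finite W] (e : V ≃ W) (D : W → Finset (Fin s))
    (H : I → Fin s → AddSubgroup G) (f : G → ℂ) :
    pairAvg (fun v ↦ D (e v)) H f = pairAvg D H f := by
  unfold pairAvg
  rw [← avg_equiv (Equiv.arrowCongr e (Equiv.refl I))]
  congr! 2 with i
  let e' : PairIndex (fun v ↦ D (e v)) ≃ PairIndex D :=
    Equiv.subtypeEquiv ((Equiv.refl _).prodCongr (e.prodCongr e)) (by simp)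
  rw [← boxAvg_equiv e']
  congr! 2
  funext q
  simp [pairFamily, e']

lemma exists_pairAvg_pow_le_of_sum_eq [Fintype V] (D : V → Finset (Fin s))
    (hD : ∑ v, 2 ^ #(D v) = 2 ^ s) : ∃ n : ℕ, n ≠ 0 ∧
    ∀ (G : Type u) [AddCommGroup G] [Finite G] (I : Type w) [Finite I]
      (H : I → Fin s → AddSubgroup G) (f : G → ℂ), (∀ x, ‖f x‖ ≤ 1) →
      pairAvg D H f ^ n ≤ pairAvg (fun _ : Fin s → Bool ↦ ∅) H f := by
  classical
  obtain ⟨k, hk⟩ : ∃ k, k + Fintype.card V = 2 ^ s := by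
    refine ⟨2 ^ s - Fintype.card V, Nat.sub_add_cancel ?_⟩
    rw [← hD, Fintype.card_eq_sum_ones]
    exact sum_le_sum fun v _ ↦ Nat.one_le_two_pow
  induction k generalizing V with
  | zero =>
    have hV : Fintype.card V = Fintype.card (Fin s → Bool) := by simpa using hk
    have hD₀ (v) : D v = ∅ := by
      rw [← hk, zero_add, Fintype.card_eq_sum_ones, eq_comm,
        sum_eq_sum_iff_of_le fun v _ ↦ Nat.one_le_two_pow] at hD
      simpa using (hD v (mem_univ v)).symm
    obtain rfl : D = fun _ ↦ ∅ := funext hD₀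
    refine ⟨1, one_ne_zero, fun G _ _ I _ H f _ ↦ ?_⟩
    rw [pow_one]
    exact (pairAvg_equiv (Fintype.equivOfCardEq hV) (fun _ ↦ ∅) H f).le
  | succ k ih =>
    obtain ⟨a, j, hj⟩ : ∃ a j, j ∈ D a := by
      by_contra! h
      have hD₀ (v) : D v = ∅ := eq_empty_of_forall_notMem (h v)
      simp only [hD₀, card_empty, pow_zero, ← Fintype.card_eq_sum_ones] at hD
      lia
    obtain ⟨m, hm, h₁⟩ := exists_pairAvg_pow_le_split (D := D) a j
    obtain ⟨n, hn, h₂⟩ := ih (splitVertex D a j) ((sum_two_pow_card_splitVertex hj).trans hD)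
      (by rw [Fintype.card_option]; lia)
    refine ⟨m * n, mul_ne_zero hm hn, fun G _ _ I _ H f hf ↦ ?_⟩
    rw [pow_mul]
    exact (pow_le_pow_left₀ (pow_nonneg (avg_nonneg fun _ ↦ norm_nonneg _) _)
      (h₁ G I H f hf) n).trans (h₂ G I H f hf)

/-- The averaged box norm is controlled by `pairAvg` with a single vertex. -/
lemma avg_norm_boxAvg_pow_le_pairAvg (H : I → Fin s → AddSubgroup G) (f : G → ℂ) :
    (avg fun i ↦ ‖boxAvg (H i) f‖) ^
        2 ^ (Nat.card (PairIndex fun _ : Unit ↦ (univ : Finset (Fin s))) - Nat.card (Fin s)) ≤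
      pairAvg (fun _ : Unit ↦ univ) H f := by
  rw [← avg_equiv (Equiv.funUnique Unit I)]
  refine avg_pow_le_avg (fun _ ↦ norm_nonneg _) (by positivity) fun i ↦ ?_
  let φ : Fin s ↪ PairIndex fun _ : Unit ↦ (univ : Finset (Fin s)) :=
    ⟨fun j ↦ ⟨(j, (), ()), .inr (mem_univ j)⟩, fun j j' h ↦ by simpa using h⟩
  exact norm_boxAvg_pow_le φ (fun j ↦ sup_idem _) f

lemma boxNorm_pow [Nonempty (Fin s)] (H : Fin s → AddSubgroup G) (f : G → ℂ) :
    boxNorm H f ^ 2 ^ s = ‖boxAvg H f‖ := by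
  rw [boxNorm_eq, boxAvg_nonneg, Complex.ofReal_re, Complex.norm_real, norm_norm, Nat.card_fin,
    one_div]
  exact_mod_cast Real.rpow_inv_natCast_pow (norm_nonneg _) (by positivity : 2 ^ s ≠ 0)

lemma norm_boxAvg_le_boxNorm {ι : Type*} [Finite ι] [Nonempty ι] (H : ι → AddSubgroup G)
    {f : G → ℂ} (hf : ∀ x, ‖f x‖ ≤ 1) : ‖boxAvg H f‖ ≤ boxNorm H f := by
  rw [boxNorm_eq, boxAvg_nonneg, Complex.ofReal_re, Complex.norm_real, norm_norm]
  refine Real.self_le_rpow_of_le_one (norm_nonneg _) (norm_boxAvg_le H hf) ?_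
  exact div_le_one_of_le₀ (one_le_pow₀ one_le_two) (by positivity)

lemma boxNorm_of_isEmpty {ι : Type*} [Finite ι] [IsEmpty ι] (H : ι → AddSubgroup G) (f : G → ℂ) :
    boxNorm H f = (avg f).re := by
  simp [boxNorm_eq, boxAvg_isEmpty]

end Concatenation

/-- Corollary 2.6, concatenation of box norms, version II:
same as version I, but the box norm on the right-hand side is indexed by `j ∈ [s]` and all
pairs `ε ≠ ε'` in `{0,1}^s`. -/
theorem statement6 (s : ℕ) :
    ∃ t : ℕ, 0 < t ∧
      ∀ (G : Type*) [AddCommGroup G] [Finite G] (I : Type*) [Finite I] [Nonempty I]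
        (H : I → Fin s → AddSubgroup G) (f : G → ℂ), (∀ x, ‖f x‖ ≤ 1) →
        (eavgR fun i : I => boxNorm (H i) f ^ 2 ^ s) ^ t ≤
          eavgR fun ii : (Fin s → Bool) → I =>
            boxNorm
              (fun q : {q : Fin s × ((Fin s → Bool) × (Fin s → Bool)) //
                  q.2.1 ≠ q.2.2} =>
                H (ii q.1.2.1) q.1.1 ⊔ H (ii q.1.2.2) q.1.1) f := by
  rcases s.eq_zero_or_pos with rfl | hs
  · refine ⟨1, one_pos, fun G _ _ I _ _ H f _ ↦ ?_⟩
    have (ii : (Fin 0 → Bool) → I) := boxNorm_of_isEmpty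
      (fun q : {q : Fin 0 × ((Fin 0 → Bool) × (Fin 0 → Bool)) // q.2.1 ≠ q.2.2} =>
        H (ii q.1.2.1) q.1.1 ⊔ H (ii q.1.2.2) q.1.1) f
    simp only [this, boxNorm_of_isEmpty, eavgR_eq_avg, avg_const, pow_zero, pow_one, le_refl]
  have : Nonempty (Fin s) := ⟨⟨0, hs⟩⟩
  have : Nonempty {q : Fin s × ((Fin s → Bool) × (Fin s → Bool)) // q.2.1 ≠ q.2.2} :=
    ⟨⟨(⟨0, hs⟩, fun _ ↦ true, fun _ ↦ false), by simp [funext_iff]⟩⟩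
  obtain ⟨n, hn, h⟩ := exists_pairAvg_pow_le_of_sum_eq
    (fun _ : Unit ↦ (univ : Finset (Fin s))) (by simp)
  let m := 2 ^ (Nat.card (PairIndex fun _ : Unit ↦ (univ : Finset (Fin s))) - Nat.card (Fin s))
  refine ⟨m * n, by positivity, fun G _ _ I _ _ H f hf ↦ ?_⟩
  simp only [boxNorm_pow, eavgR_eq_avg]
  rw [pow_mul]
  refine (pow_le_pow_left₀ (pow_nonneg (avg_nonneg fun _ ↦ norm_nonneg _) _)
    (avg_norm_boxAvg_pow_le_pairAvg H f) n).trans <| (h G I H f hf).trans <|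
      avg_mono fun ii ↦ le_trans (le_of_eq ?_) (norm_boxAvg_le_boxNorm _ hf)
  let e : {q : Fin s × ((Fin s → Bool) × (Fin s → Bool)) // q.2.1 ≠ q.2.2} ≃
      PairIndex fun _ : Fin s → Bool ↦ (∅ : Finset (Fin s)) :=
    Equiv.subtypeEquivRight fun q ↦ by simp
  rw [← boxAvg_equiv e]
  rfl

end
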